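/- The function G(a) = ∫_ℝ φ(x)·Φ(x)·Φ(a·x) dx is differentiable on [0,∞), and for every a ≥ 0 its derivative equals G′(a) = 1 / ( 2π·(1+a²)·√(2+a²) ). -/

import Mathlib

open MeasureTheory Real

/-- The standard normal density. -/
noncomputable def stdNormalPDF (x : ℝ) : ℝ :=
  (1 / Real.sqrt (2 * Real.pi)) * Real.exp (-x^2 / 2)

/-- The standard normal cumulative distribution function. -/
noncomputable def stdNormalCDF (x : ℝ) : ℝ :=
  ∫ t in Set.Iic x, stdNormalPDF t

theorem stdNormalPDF_eq (x : ℝ) :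
    stdNormalPDF x = (√(2 * π))⁻¹ * exp (-(1 / 2) * x ^ 2) := by
  rw [stdNormalPDF, one_div]
  ring_nf

theorem stdNormalPDF_nonneg (x : ℝ) : 0 ≤ stdNormalPDF x := by
  unfold stdNormalPDF
  positivity

theorem stdNormalPDF_le_one (x : ℝ) : stdNormalPDF x ≤ 1 := by
  rw [stdNormalPDF_eq]
  have h : 1 ≤ √(2 * π) := one_le_sqrt.2 (by linarith [pi_gt_three])
  exact mul_le_one₀ (inv_le_one_of_one_le₀ h) (exp_nonneg _)
    (exp_le_one_iff.2 (by nlinarith [sq_nonneg x]))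

theorem continuous_stdNormalPDF : Continuous stdNormalPDF := by
  unfold stdNormalPDF
  fun_prop

theorem hasDerivAt_stdNormalPDF (x : ℝ) :
    HasDerivAt stdNormalPDF (-x * stdNormalPDF x) x := by
  have h : HasDerivAt (fun y : ℝ => -y ^ 2 / 2) (-x) x := by
    convert! ((hasDerivAt_pow 2 x).neg.div_const 2) using 1
    simp
    ring
  convert! (h.exp.const_mul (1 / √(2 * π))) using 1
  rw [stdNormalPDF]
  ring

theorem integrable_stdNormalPDF : Integrable stdNormalPDF := by
  have h := (integrable_exp_neg_mul_sq (b := 1 / 2) (by norm_num)).const_mul (√(2 * π))⁻¹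
  exact h.congr (.of_forall fun x => (stdNormalPDF_eq x).symm)

theorem integrable_mul_stdNormalPDF : Integrable fun x => x * stdNormalPDF x := by
  have h := (integrable_mul_exp_neg_mul_sq (b := 1 / 2) (by norm_num)).const_mul (√(2 * π))⁻¹
  refine h.congr (.of_forall fun x => ?_)
  simp only [stdNormalPDF_eq]
  ring

theorem integral_stdNormalPDF : ∫ x, stdNormalPDF x = 1 := by
  simp_rw [stdNormalPDF_eq]
  rw [integral_const_mul, integral_gaussian, show π / (1 / 2) = 2 * π by ring]
  exact inv_mul_cancel₀ (by positivity)

theorem stdNormalCDF_nonneg (x : ℝ) : 0 ≤ stdNormalCDF x :=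
  integral_nonneg stdNormalPDF_nonneg

theorem stdNormalCDF_le_one (x : ℝ) : stdNormalCDF x ≤ 1 := by
  rw [← integral_stdNormalPDF]
  exact setIntegral_le_integral integrable_stdNormalPDF (.of_forall stdNormalPDF_nonneg)

theorem hasDerivAt_stdNormalCDF (x : ℝ) : HasDerivAt stdNormalCDF (stdNormalPDF x) x := by
  have h : stdNormalCDF = fun y => (∫ t in (0 : ℝ)..y, stdNormalPDF t) + stdNormalCDF 0 := by
    ext y
    rw [← intervalIntegral.integral_Iic_sub_Iic integrable_stdNormalPDF.integrableOn
      integrable_stdNormalPDF.integrableOn]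
    simp [stdNormalCDF]
  rw [h]
  exact (continuous_stdNormalPDF.integral_hasStrictDerivAt 0 x).hasDerivAt.add_const _

theorem continuous_stdNormalCDF : Continuous stdNormalCDF :=
  continuous_iff_continuousAt.2 fun x => (hasDerivAt_stdNormalCDF x).continuousAt

theorem integral_stdNormalPDF_sq_mul_stdNormalPDF_mul (a : ℝ) :
    ∫ x, stdNormalPDF x * stdNormalPDF x * stdNormalPDF (a * x) =
      1 / (2 * π * √(2 + a ^ 2)) := by
  have h (x : ℝ) : stdNormalPDF x * stdNormalPDF x * stdNormalPDF (a * x) =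
      (√(2 * π))⁻¹ ^ 3 * exp (-((2 + a ^ 2) / 2) * x ^ 2) := by
    simp only [stdNormalPDF_eq]
    rw [show -((2 + a ^ 2) / 2) * x ^ 2 =
      -(1 / 2) * x ^ 2 + -(1 / 2) * x ^ 2 + -(1 / 2) * (a * x) ^ 2 by ring, exp_add, exp_add]
    ring
  simp_rw [h]
  rw [integral_const_mul, integral_gaussian,
    show π / ((2 + a ^ 2) / 2) = 2 * π / (2 + a ^ 2) by field_simp, sqrt_div (by positivity)]
  field_simp
  rw [sq_sqrt (by positivity)]

theorem integrable_stdNormalPDF_mul {g : ℝ → ℝ} (hg : Continuous g) (hb : ∀ x, |g x| ≤ 1) :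
    Integrable fun x => stdNormalPDF x * g x :=
  integrable_stdNormalPDF.mul_bdd hg.aestronglyMeasurable (.of_forall hb)

theorem integrable_mul_stdNormalPDF_mul {g : ℝ → ℝ} (hg : Continuous g) (hb : ∀ x, |g x| ≤ 1) :
    Integrable fun x => x * stdNormalPDF x * g x :=
  integrable_mul_stdNormalPDF.mul_bdd hg.aestronglyMeasurable (.of_forall hb)

theorem abs_stdNormalCDF_le_one (x : ℝ) : |stdNormalCDF x| ≤ 1 := by
  rw [abs_of_nonneg (stdNormalCDF_nonneg x)]
  exact stdNormalCDF_le_one x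

theorem abs_stdNormalPDF_le_one (x : ℝ) : |stdNormalPDF x| ≤ 1 := by
  rw [abs_of_nonneg (stdNormalPDF_nonneg x)]
  exact stdNormalPDF_le_one x

theorem abs_mul_le_one_of_abs_le_one {u v : ℝ} (hu : |u| ≤ 1) (hv : |v| ≤ 1) :
    |u * v| ≤ 1 := by
  rw [abs_mul]
  exact mul_le_one₀ hu (abs_nonneg v) hv

/-- Integration by parts, using that `-φ(x) φ(ax) / (1 + a²)` is a primitive of `x φ(x) φ(ax)`. -/
theorem integral_mul_stdNormalPDF_mul_stdNormalCDF_mul_stdNormalPDF (a : ℝ) :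
    ∫ x, x * stdNormalPDF x * (stdNormalCDF x * stdNormalPDF (a * x)) =
      1 / (2 * π * (1 + a ^ 2) * √(2 + a ^ 2)) := by
  have hne : 1 + a ^ 2 ≠ 0 := by positivity
  have cp := continuous_stdNormalPDF
  have cc := continuous_stdNormalCDF
  have hv (x : ℝ) : HasDerivAt (fun y => -(1 + a ^ 2)⁻¹ * (stdNormalPDF y * stdNormalPDF (a * y)))
      (x * stdNormalPDF x * stdNormalPDF (a * x)) x := by
    have hl : HasDerivAt (fun y : ℝ => a * y) a x := by
      simpa using (hasDerivAt_id x).const_mul a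
    have hc := (hasDerivAt_stdNormalPDF (a * x)).comp x hl
    convert! (((hasDerivAt_stdNormalPDF x).mul hc).const_mul (-(1 + a ^ 2)⁻¹)) using 1
    simp only [Function.comp_apply]
    field_simp
    ring
  have key := integral_mul_deriv_eq_deriv_mul_of_integrable
    (fun x _ => hasDerivAt_stdNormalCDF x) (fun x _ => hv x)
    ((integrable_mul_stdNormalPDF_mul (g := fun x => stdNormalCDF x * stdNormalPDF (a * x))
      (by fun_prop) fun x => abs_mul_le_one_of_abs_le_one (abs_stdNormalCDF_le_one x)
        (abs_stdNormalPDF_le_one _)).congr (.of_forall fun x => by simp only [Pi.mul_apply]; ring))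
    (((integrable_stdNormalPDF_mul (g := fun x => stdNormalPDF x * stdNormalPDF (a * x))
      (by fun_prop) fun x => abs_mul_le_one_of_abs_le_one (abs_stdNormalPDF_le_one x)
        (abs_stdNormalPDF_le_one _)).const_mul (-(1 + a ^ 2)⁻¹)).congr
          (.of_forall fun x => by simp only [Pi.mul_apply]; ring))
    (((integrable_stdNormalPDF_mul (g := fun x => stdNormalCDF x * stdNormalPDF (a * x))
      (by fun_prop) fun x => abs_mul_le_one_of_abs_le_one (abs_stdNormalCDF_le_one x)
        (abs_stdNormalPDF_le_one _)).const_mul (-(1 + a ^ 2)⁻¹)).congr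
          (.of_forall fun x => by simp only [Pi.mul_apply]; ring))
  calc ∫ x, x * stdNormalPDF x * (stdNormalCDF x * stdNormalPDF (a * x))
      = ∫ x, stdNormalCDF x * (x * stdNormalPDF x * stdNormalPDF (a * x)) := by
        congr with x; ring
    _ = (1 + a ^ 2)⁻¹ * ∫ x, stdNormalPDF x * stdNormalPDF x * stdNormalPDF (a * x) := by
        rw [key, ← integral_neg, ← integral_const_mul]
        congr with x; ring
    _ = 1 / (2 * π * (1 + a ^ 2) * √(2 + a ^ 2)) := by
        rw [integral_stdNormalPDF_sq_mul_stdNormalPDF_mul]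
        field_simp

/-- The function `G(a) = ∫ φ(x) Φ(x) Φ(ax) dx` is differentiable on `[0,∞)` (one-sidedly at `0`)
with derivative `G′(a) = 1/(2π (1+a²) √(2+a²))`. -/
theorem hasDerivWithinAt_integral_pdf_cdf_cdf (a : ℝ) (ha : 0 ≤ a) :
    HasDerivWithinAt (fun b : ℝ => ∫ x : ℝ, stdNormalPDF x * stdNormalCDF x * stdNormalCDF (b * x))
      (1 / (2 * Real.pi * (1 + a^2) * Real.sqrt (2 + a^2))) (Set.Ici 0) a := by
  have cp := continuous_stdNormalPDF
  have cc := continuous_stdNormalCDF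
  rw [← integral_mul_stdNormalPDF_mul_stdNormalCDF_mul_stdNormalPDF]
  refine (hasDerivAt_integral_of_dominated_loc_of_deriv_le
    (F' := fun b x => x * stdNormalPDF x * (stdNormalCDF x * stdNormalPDF (b * x)))
    (bound := fun x => |x * stdNormalPDF x|) Filter.univ_mem
    (.of_forall fun b => (by fun_prop : Continuous _).aestronglyMeasurable) ?_
    (by fun_prop : Continuous _).aestronglyMeasurable (.of_forall fun x b _ => ?_)
    integrable_mul_stdNormalPDF.abs (.of_forall fun x b _ => ?_)).2.hasDerivWithinAt
  · simpa only [mul_assoc] using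
      integrable_stdNormalPDF_mul (g := fun x => stdNormalCDF x * stdNormalCDF (a * x))
        (by fun_prop) fun x => abs_mul_le_one_of_abs_le_one (abs_stdNormalCDF_le_one x)
          (abs_stdNormalCDF_le_one _)
  · rw [norm_eq_abs, abs_mul]
    exact mul_le_of_le_one_right (abs_nonneg _)
      (abs_mul_le_one_of_abs_le_one (abs_stdNormalCDF_le_one x) (abs_stdNormalPDF_le_one _))
  · have hl : HasDerivAt (fun y : ℝ => y * x) x b := by
      simpa using (hasDerivAt_id b).mul_const x
    convert! ((hasDerivAt_stdNormalCDF (b * x)).comp b hl).const_mul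
      (stdNormalPDF x * stdNormalCDF x) using 1
    ring
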